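/- (Lemma 4) Any two-color Babylon position consisting of 3 red singleton stacks, k blue singleton stacks with k ≥ 3 odd (so that the total number of stacks, k+5, is even), exactly one red stack of height 2u, and exactly one blue stack of height 2v, where u ≥ 1, v ≥ 1 and u+v ≥ 3, is not a first-player win; that is, the player to move loses with best play. -/

import Mathlib

/-- A chip color: `true` = red, `false` = blue.  A stack is a nonempty list of
chips, the head of the list being the top chip; the color of a stack is the
color of its top chip.  A position is a finite multiset of stacks. -/
abbrev Stack := List Bool

abbrev Position := Multiset Stack

/-- A legal move replaces two stacks `s` and `t` that have equal length or
equal top color by the single concatenated stack `s ++ t`. -/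
def Move (P Q : Position) : Prop :=
  ∃ s t : Stack, s ≠ [] ∧ t ≠ [] ∧ s ∈ P ∧ t ∈ P.erase s ∧
    (s.length = t.length ∨ s.head? = t.head?) ∧
    Q = (s ++ t) ::ₘ (P.erase s).erase t

/-- Auxiliary predicate, with the number of stacks as fuel: the player to move
wins iff there is a legal move to a position that is not a first-player win. -/
def FirstWinAux : ℕ → Position → Prop
  | 0, _ => False
  | n + 1, P => ∃ Q, Move P Q ∧ ¬ FirstWinAux n Q

/-- The position is a first-player win: the player to move has a winning
strategy.  Since each move decreases the number of stacks by exactly one,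
`Multiset.card P` is enough fuel. -/
def FirstWin (P : Position) : Prop := FirstWinAux (Multiset.card P) P

/-- The initial position with `p` red singleton stacks and `q` blue
singleton stacks. -/
def initPos (p q : ℕ) : Position :=
  Multiset.replicate p [true] + Multiset.replicate q [false]

namespace Babylon

open Multiset

/-- `Merge M N`: two entries of `M` are replaced by their sum. -/
def Merge (M N : Multiset ℕ) : Prop :=
  ∃ x y K, M = x ::ₘ y ::ₘ K ∧ N = (x + y) ::ₘ K

/-- A Babylon move, seen on the multisets `R`, `B` of heights of red and of blue stacks. -/
def Step (R B R' B' : Multiset ℕ) : Prop :=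
  Merge R R' ∧ B' = B ∨ Merge B B' ∧ R' = R ∨
    ∃ h R₀ B₀, R = h ::ₘ R₀ ∧ B = h ::ₘ B₀ ∧
      (R' = 2 * h ::ₘ R₀ ∧ B' = B₀ ∨ R' = R₀ ∧ B' = 2 * h ::ₘ B₀)

mutual

/-- The player to move loses. -/
inductive Lose : Multiset ℕ → Multiset ℕ → Prop
  | mk {R B : Multiset ℕ} (h : ∀ R' B', Step R B R' B' → Win R' B') : Lose R B

/-- The player to move wins. -/
inductive Win : Multiset ℕ → Multiset ℕ → Prop
  | mk {R B R' B' : Multiset ℕ} (h : Step R B R' B') (hl : Lose R' B') : Win R B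

end

theorem Merge.card {M N : Multiset ℕ} (h : Merge M N) : card M = card N + 1 := by
  obtain ⟨x, y, K, rfl, rfl⟩ := h
  simp

theorem Step.card {R B R' B' : Multiset ℕ} (h : Step R B R' B') :
    card R + card B = card R' + card B' + 1 := by
  rcases h with ⟨h, rfl⟩ | ⟨h, rfl⟩ | ⟨h, R₀, B₀, rfl, rfl, ⟨rfl, rfl⟩ | ⟨rfl, rfl⟩⟩
  · have := h.card; omega
  · have := h.card; omega
  · simp; omega
  · simp; omega

theorem Step.symm {R B R' B' : Multiset ℕ} (h : Step R B R' B') : Step B R B' R' := by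
  rcases h with h | h | ⟨h, R₀, B₀, hR, hB, hh⟩
  · exact .inr (.inl h)
  · exact .inl h
  · exact .inr (.inr ⟨h, B₀, R₀, hB, hR, by tauto⟩)

mutual

theorem Lose.symm {R B : Multiset ℕ} : Lose R B → Lose B R
  | .mk h => .mk fun R' B' hs => (h B' R' hs.symm).symm

theorem Win.symm {R B : Multiset ℕ} : Win R B → Win B R
  | .mk h hl => .mk h.symm hl.symm

end

/-- The red stacks `PR` and blue stacks `PB` of `P` have heights `R` and `B`. -/
def Heights (P : Position) (R B : Multiset ℕ) : Prop :=
  ∃ PR PB : Position, P = PR + PB ∧ (∀ s ∈ PR, s.head? = some true) ∧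
    (∀ s ∈ PB, s.head? = some false) ∧ PR.map List.length = R ∧ PB.map List.length = B

theorem Heights.card {P : Position} {R B : Multiset ℕ} (h : Heights P R B) :
    card P = card R + card B := by
  obtain ⟨PR, PB, rfl, -, -, rfl, rfl⟩ := h
  simp

theorem Move.exists_cons {P Q : Position} : Move P Q ↔ ∃ s t K, s ≠ [] ∧ t ≠ [] ∧
    P = s ::ₘ t ::ₘ K ∧ (s.length = t.length ∨ s.head? = t.head?) ∧ Q = (s ++ t) ::ₘ K := by
  constructor
  · rintro ⟨s, t, hs, ht, h1, h2, h3, rfl⟩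
    exact ⟨s, t, _, hs, ht, by rw [cons_erase h2, cons_erase h1], h3, rfl⟩
  · rintro ⟨s, t, K, hs, ht, rfl, h3, rfl⟩
    exact ⟨s, t, hs, ht, by simp, by simp, h3, by simp⟩

theorem exists_of_map_eq_cons {P : Position} {x : ℕ} {K : Multiset ℕ}
    (h : P.map List.length = x ::ₘ K) : ∃ s P', P = s ::ₘ P' ∧ s.length = x ∧
      P'.map List.length = K := by
  obtain ⟨s, hs, hx, hK⟩ := (Multiset.map_eq_cons _ _ _ _).2 h
  exact ⟨s, P.erase s, (cons_erase hs).symm, hx, hK⟩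

theorem Heights.move {P : Position} {R B R' B' : Multiset ℕ} (h : Heights P R B)
    (hs : Step R B R' B') : ∃ Q, Move P Q ∧ Heights Q R' B' := by
  obtain ⟨PR, PB, rfl, hr, hb, h1, h2⟩ := h
  have ne : ∀ {s : Stack} {c}, s.head? = some c → s ≠ [] := by
    rintro s c h rfl; simp at h
  have happ : ∀ {s t : Stack} {c}, s.head? = some c → (s ++ t).head? = some c := by
    intro s t c h; simp [List.head?_append, h]
  rcases hs with ⟨⟨x, y, K, rfl, rfl⟩, rfl⟩ | ⟨⟨x, y, K, rfl, rfl⟩, rfl⟩ |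
    ⟨x, R₀, B₀, rfl, rfl, hh⟩
  · obtain ⟨s, PR, rfl, rfl, h1'⟩ := exists_of_map_eq_cons h1
    obtain ⟨t, PR, rfl, rfl, rfl⟩ := exists_of_map_eq_cons h1'
    simp only [mem_cons, forall_eq_or_imp] at hr
    refine ⟨(s ++ t) ::ₘ (PR + PB), Move.exists_cons.2 ⟨s, t, _, ne hr.1, ne hr.2.1, by simp,
      .inr (by rw [hr.1, hr.2.1]), rfl⟩, (s ++ t) ::ₘ PR, PB, by simp, ?_, hb, by simp, h2⟩
    simpa only [mem_cons, forall_eq_or_imp] using ⟨happ hr.1, hr.2.2⟩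
  · obtain ⟨s, PB, rfl, rfl, h2'⟩ := exists_of_map_eq_cons h2
    obtain ⟨t, PB, rfl, rfl, rfl⟩ := exists_of_map_eq_cons h2'
    simp only [mem_cons, forall_eq_or_imp] at hb
    refine ⟨(s ++ t) ::ₘ (PR + PB), Move.exists_cons.2 ⟨s, t, _, ne hb.1, ne hb.2.1, by simp,
      .inr (by rw [hb.1, hb.2.1]), rfl⟩, PR, (s ++ t) ::ₘ PB, by simp, hr, ?_, h1, by simp⟩
    simpa only [mem_cons, forall_eq_or_imp] using ⟨happ hb.1, hb.2.2⟩
  · obtain ⟨s, PR, rfl, hs, rfl⟩ := exists_of_map_eq_cons h1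
    obtain ⟨t, PB, rfl, rfl, rfl⟩ := exists_of_map_eq_cons h2
    simp only [mem_cons, forall_eq_or_imp] at hb hr
    rcases hh with ⟨rfl, rfl⟩ | ⟨rfl, rfl⟩
    · refine ⟨(s ++ t) ::ₘ (PR + PB), Move.exists_cons.2 ⟨s, t, _, ne hr.1, ne hb.1,
        by rw [cons_add, add_cons], .inl hs, rfl⟩, (s ++ t) ::ₘ PR, PB, by simp, ?_, hb.2,
        by simp; omega, rfl⟩
      simpa only [mem_cons, forall_eq_or_imp] using ⟨happ hr.1, hr.2⟩
    · refine ⟨(t ++ s) ::ₘ (PR + PB), Move.exists_cons.2 ⟨t, s, _, ne hb.1, ne hr.1, ?_,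
        .inl hs.symm, rfl⟩, PR, (t ++ s) ::ₘ PB, by simp, hr.2, ?_, rfl, by simp; omega⟩
      · rw [cons_add, add_cons, cons_swap]
      · simpa only [mem_cons, forall_eq_or_imp] using ⟨happ hb.1, hb.2⟩

theorem Heights.of_move {P Q : Position} {R B : Multiset ℕ} (h : Heights P R B)
    (hm : Move P Q) : ∃ R' B', Step R B R' B' ∧ Heights Q R' B' := by
  obtain ⟨PR, PB, hP, hr, hb, rfl, rfl⟩ := h
  obtain ⟨s, t, K, hs, ht, rfl, hst, rfl⟩ := Move.exists_cons.1 hm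
  have happ : ∀ {s t : Stack} {c}, s.head? = some c → (s ++ t).head? = some c := by
    intro s t c h; simp [List.head?_append, h]
  have hs' : s ∈ PR + PB := hP ▸ by simp
  rcases mem_add.1 hs' with h | h <;> obtain ⟨L, rfl⟩ := exists_cons_of_mem h
  · have hK : t ::ₘ K = L + PB := by simpa using hP
    simp only [mem_cons, forall_eq_or_imp] at hr
    have ht' : t ∈ L + PB := hK ▸ by simp
    rcases mem_add.1 ht' with h' | h' <;> obtain ⟨L', rfl⟩ := exists_cons_of_mem h'
    · obtain rfl : K = L' + PB := by simpa using hK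
      simp only [mem_cons, forall_eq_or_imp] at hr
      refine ⟨_, _, .inl ⟨⟨s.length, t.length, L'.map List.length, by simp, rfl⟩, rfl⟩,
        (s ++ t) ::ₘ L', PB, by simp, ?_, hb, by simp, rfl⟩
      simpa only [mem_cons, forall_eq_or_imp] using ⟨happ hr.1, hr.2.2⟩
    · obtain rfl : K = L + L' := by simpa using hK
      simp only [mem_cons, forall_eq_or_imp] at hb
      have hl : s.length = t.length := by
        rcases hst with h | h
        · exact h
        · simp [hr.1, hb.1] at h
      refine ⟨_, _, .inr (.inr ⟨s.length, L.map List.length, L'.map List.length, by simp,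
        by simp [hl], .inl ⟨rfl, rfl⟩⟩), (s ++ t) ::ₘ L, L', by simp, ?_, hb.2,
        by simp; omega, rfl⟩
      simpa only [mem_cons, forall_eq_or_imp] using ⟨happ hr.1, hr.2⟩
  · have hK : t ::ₘ K = PR + L := by simpa using hP
    simp only [mem_cons, forall_eq_or_imp] at hb
    have ht' : t ∈ PR + L := hK ▸ by simp
    rcases mem_add.1 ht' with h' | h' <;> obtain ⟨L', rfl⟩ := exists_cons_of_mem h'
    · obtain rfl : K = L' + L := by simpa using hK
      simp only [mem_cons, forall_eq_or_imp] at hr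
      have hl : s.length = t.length := by
        rcases hst with h | h
        · exact h
        · simp [hr.1, hb.1] at h
      refine ⟨_, _, .inr (.inr ⟨s.length, L'.map List.length, L.map List.length, by simp [hl],
        by simp, .inr ⟨rfl, rfl⟩⟩), L', (s ++ t) ::ₘ L, by simp, hr.2, ?_, rfl,
        by simp; omega⟩
      simpa only [mem_cons, forall_eq_or_imp] using ⟨happ hb.1, hb.2⟩
    · obtain rfl : K = PR + L' := by simpa using hK
      simp only [mem_cons, forall_eq_or_imp] at hb
      refine ⟨_, _, .inr (.inl ⟨⟨s.length, t.length, L'.map List.length, by simp, rfl⟩, rfl⟩),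
        PR, (s ++ t) ::ₘ L', by simp, hr, ?_, rfl, by simp⟩
      simpa only [mem_cons, forall_eq_or_imp] using ⟨happ hb.1, hb.2.2⟩

theorem firstWinAux_of_heights (n : ℕ) : ∀ {P : Position} {R B : Multiset ℕ}, Heights P R B →
    Multiset.card P = n →
    (Lose R B → ¬ FirstWinAux n P) ∧ (Win R B → FirstWinAux n P) := by
  induction n with
  | zero =>
    intro P R B h hn
    refine ⟨fun _ h => h, ?_⟩
    rintro ⟨hs, -⟩
    have := hs.card
    have := h.card
    omega
  | succ n ih =>
    intro P R B h hn
    constructor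
    · rintro ⟨hl⟩ ⟨Q, hm, hQ⟩
      obtain ⟨R', B', hs, hh⟩ := h.of_move hm
      have := hs.card
      have := h.card
      have := hh.card
      exact hQ ((ih hh (by omega)).2 (hl _ _ hs))
    · rintro ⟨hs, hl⟩
      obtain ⟨Q, hm, hh⟩ := h.move hs
      have := hs.card
      have := h.card
      have := hh.card
      exact ⟨Q, hm, (ih hh (by omega)).1 hl⟩

theorem Merge.sum {M N : Multiset ℕ} (h : Merge M N) : N.sum = M.sum := by
  obtain ⟨x, y, K, rfl, rfl⟩ := h
  simp [add_assoc]

theorem Merge.zero_notMem {M N : Multiset ℕ} (h : Merge M N) (h0 : 0 ∉ M) : 0 ∉ N := by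
  obtain ⟨x, y, K, rfl, rfl⟩ := h
  simp only [mem_cons, not_or] at h0 ⊢
  exact ⟨by omega, h0.2.2⟩

theorem Merge.count_le {M N : Multiset ℕ} (h : Merge M N) (a : ℕ) :
    count a N ≤ count a M + 1 := by
  obtain ⟨x, y, K, rfl, rfl⟩ := h
  simp only [count_cons]
  split_ifs <;> omega

theorem Merge.exists_lt {M N : Multiset ℕ} (h : Merge M N) {a : ℕ} (ha : ∃ x ∈ M, a < x) :
    ∃ x ∈ N, a < x := by
  obtain ⟨x, y, K, rfl, rfl⟩ := h
  obtain ⟨z, hz, haz⟩ := ha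
  simp only [mem_cons] at hz ⊢
  rcases hz with rfl | rfl | hz
  · exact ⟨_, .inl rfl, by omega⟩
  · exact ⟨_, .inl rfl, by omega⟩
  · exact ⟨z, .inr hz, haz⟩

theorem merge_cons {c : ℕ} {M N : Multiset ℕ} (h : Merge (c ::ₘ M) N) :
    (∃ y K, M = y ::ₘ K ∧ N = (c + y) ::ₘ K) ∨ ∃ K, Merge M K ∧ N = c ::ₘ K := by
  obtain ⟨x, y, K, h, rfl⟩ := h
  rcases cons_eq_cons.1 h with ⟨rfl, rfl⟩ | ⟨-, K', rfl, h'⟩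
  · exact .inl ⟨y, K, rfl, rfl⟩
  · rcases cons_eq_cons.1 h' with ⟨rfl, rfl⟩ | ⟨-, K', rfl, rfl⟩
    · exact .inl ⟨x, K, rfl, by rw [add_comm]⟩
    · exact .inr ⟨_, ⟨x, y, K', rfl, rfl⟩, cons_swap _ _ _⟩

theorem not_merge_zero {N : Multiset ℕ} : ¬ Merge 0 N := by
  rintro ⟨x, y, K, h, -⟩
  simp at h

theorem not_merge_singleton {a : ℕ} {N : Multiset ℕ} : ¬ Merge (a ::ₘ 0) N := by
  intro hm
  rcases merge_cons hm with ⟨x, K, h, -⟩ | ⟨x, h, -⟩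
  · simp at h
  · exact not_merge_zero h

theorem merge_pair {a b : ℕ} {N : Multiset ℕ} (hm : Merge (a ::ₘ b ::ₘ 0) N) :
    N = (a + b) ::ₘ 0 := by
  rcases merge_cons hm with ⟨x, K, h, rfl⟩ | ⟨x, h, -⟩
  · rcases cons_eq_cons.1 h with ⟨rfl, rfl⟩ | ⟨-, K, h, -⟩
    · rfl
    · simp at h
  · exact (not_merge_singleton h).elim

theorem replicate_eq_cons {n y : ℕ} {K : Multiset ℕ} (h : replicate n 1 = y ::ₘ K) :
    1 ≤ n ∧ y = 1 ∧ K = replicate (n - 1) 1 := by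
  have hy : y = 1 := eq_of_mem_replicate (h ▸ mem_cons_self y K : y ∈ replicate n 1)
  have hn : n = card K + 1 := by simpa using congrArg card h
  subst hy hn
  exact ⟨by omega, rfl, by simpa [replicate_succ] using h.symm⟩

theorem replicate_one_eq_cons {n : ℕ} (h : 1 ≤ n) :
    replicate n 1 = 1 ::ₘ replicate (n - 1) 1 := by
  obtain ⟨n, rfl⟩ := Nat.exists_eq_add_of_le' h
  simp [replicate_succ]

theorem merge_replicate {n : ℕ} {N : Multiset ℕ} (hm : Merge (replicate n 1) N) :
    2 ≤ n ∧ N = 2 ::ₘ replicate (n - 2) 1 := by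
  obtain ⟨x, y, K, h, rfl⟩ := hm
  obtain ⟨h1, rfl, h'⟩ := replicate_eq_cons h
  obtain ⟨h2, rfl, rfl⟩ := replicate_eq_cons h'.symm
  exact ⟨by omega, rfl⟩

theorem merge_cons_replicate {c n : ℕ} {N : Multiset ℕ} (hm : Merge (c ::ₘ replicate n 1) N) :
    (1 ≤ n ∧ N = (c + 1) ::ₘ replicate (n - 1) 1) ∨
      (2 ≤ n ∧ N = 2 ::ₘ c ::ₘ replicate (n - 2) 1) := by
  rcases merge_cons hm with ⟨y, K, h, rfl⟩ | ⟨K, h, rfl⟩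
  · obtain ⟨h1, rfl, rfl⟩ := replicate_eq_cons h
    exact .inl ⟨h1, rfl⟩
  · obtain ⟨h1, rfl⟩ := merge_replicate h
    exact .inr ⟨h1, cons_swap _ _ _⟩

theorem merge_cons_cons_replicate {c d n : ℕ} {N : Multiset ℕ}
    (hm : Merge (c ::ₘ d ::ₘ replicate n 1) N) :
    N = (c + d) ::ₘ replicate n 1 ∨
    (1 ≤ n ∧ N = (c + 1) ::ₘ d ::ₘ replicate (n - 1) 1) ∨
    (1 ≤ n ∧ N = (d + 1) ::ₘ c ::ₘ replicate (n - 1) 1) ∨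
    (2 ≤ n ∧ N = 2 ::ₘ c ::ₘ d ::ₘ replicate (n - 2) 1) := by
  rcases merge_cons hm with ⟨y, K, h, rfl⟩ | ⟨K, h, rfl⟩
  · rcases cons_eq_cons.1 h with ⟨rfl, rfl⟩ | ⟨-, K, h', rfl⟩
    · exact .inl rfl
    · obtain ⟨h1, rfl, rfl⟩ := replicate_eq_cons h'
      exact .inr (.inl ⟨h1, rfl⟩)
  · rcases merge_cons_replicate h with ⟨h1, rfl⟩ | ⟨h1, rfl⟩
    · exact .inr (.inr (.inl ⟨h1, cons_swap _ _ _⟩))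
    · exact .inr (.inr (.inr ⟨h1, cons_swap _ _ _⟩))

theorem Win.red {a b : ℕ} {R R₀ B : Multiset ℕ} (hR : R = a ::ₘ b ::ₘ R₀)
    (h : Lose ((a + b) ::ₘ R₀) B) : Win R B :=
  .mk (.inl ⟨⟨a, b, R₀, hR, rfl⟩, rfl⟩) h

theorem Win.blue {a b : ℕ} {R B B₀ : Multiset ℕ} (hB : B = a ::ₘ b ::ₘ B₀)
    (h : Lose R ((a + b) ::ₘ B₀)) : Win R B :=
  .mk (.inr (.inl ⟨⟨a, b, B₀, hB, rfl⟩, rfl⟩)) h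

theorem Win.flipRed {a : ℕ} {R R₀ B B₀ : Multiset ℕ} (hR : R = a ::ₘ R₀) (hB : B = a ::ₘ B₀)
    (h : Lose (2 * a ::ₘ R₀) B₀) : Win R B :=
  .mk (.inr (.inr ⟨a, R₀, B₀, hR, hB, .inl ⟨rfl, rfl⟩⟩)) h

theorem Win.flipBlue {a : ℕ} {R R₀ B B₀ : Multiset ℕ} (hR : R = a ::ₘ R₀) (hB : B = a ::ₘ B₀)
    (h : Lose R₀ (2 * a ::ₘ B₀)) : Win R B :=
  .mk (.inr (.inr ⟨a, R₀, B₀, hR, hB, .inr ⟨rfl, rfl⟩⟩)) h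

/-- The options of the mover when the red stack `a` can be combined with an equally high blue one. -/
def FlipWin (a : ℕ) (R B : Multiset ℕ) : Prop :=
  a ∉ B ∨ ∃ B₀, B = a ::ₘ B₀ ∧ Win (2 * a ::ₘ R) B₀ ∧ Win R (2 * a ::ₘ B₀)

theorem FlipWin.win {a : ℕ} {R B B₀ : Multiset ℕ} (h : FlipWin a R B) (hB : B = a ::ₘ B₀) :
    Win (2 * a ::ₘ R) B₀ ∧ Win R (2 * a ::ₘ B₀) := by
  rcases h with h | ⟨B₁, rfl, h⟩
  · simp [hB] at h
  · rw [cons_inj_right] at hB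
    exact hB ▸ h

theorem lose_singleton {a : ℕ} {B : Multiset ℕ} (ha : a ∉ B)
    (hB : ∀ B', Merge B B' → Win (a ::ₘ 0) B') : Lose (a ::ₘ 0) B := by
  refine .mk fun R' B' hs => ?_
  rcases hs with ⟨h, rfl⟩ | ⟨h, rfl⟩ | ⟨h, R₀, B₀, h1, rfl, -⟩
  · exact (not_merge_singleton h).elim
  · exact hB _ h
  · rcases cons_eq_cons.1 h1 with ⟨rfl, -⟩ | ⟨-, K, h, -⟩
    · simp at ha
    · simp at h

theorem lose_pair {a b : ℕ} {B : Multiset ℕ} (hR : Win ((a + b) ::ₘ 0) B)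
    (hB : ∀ B', Merge B B' → Win (a ::ₘ b ::ₘ 0) B')
    (ha : FlipWin a (b ::ₘ 0) B) (hb : FlipWin b (a ::ₘ 0) B) : Lose (a ::ₘ b ::ₘ 0) B := by
  refine .mk fun R' B' hs => ?_
  rcases hs with ⟨h, rfl⟩ | ⟨h, rfl⟩ | ⟨h, R₀, B₀, h1, rfl, hh⟩
  · exact merge_pair h ▸ hR
  · exact hB _ h
  · rcases cons_eq_cons.1 h1 with ⟨rfl, rfl⟩ | ⟨-, K, h1', rfl⟩
    · have := ha.win rfl
      rcases hh with ⟨rfl, rfl⟩ | ⟨rfl, rfl⟩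
      exacts [this.1, this.2]
    rcases cons_eq_cons.1 h1' with ⟨rfl, rfl⟩ | ⟨-, K, h1'', rfl⟩
    · have := hb.win rfl
      rcases hh with ⟨rfl, rfl⟩ | ⟨rfl, rfl⟩
      exacts [this.1, this.2]
    · simp at h1''

theorem lose_triple {a b c : ℕ} {B : Multiset ℕ} (hab : Win ((a + b) ::ₘ c ::ₘ 0) B)
    (hac : Win ((a + c) ::ₘ b ::ₘ 0) B) (hbc : Win ((b + c) ::ₘ a ::ₘ 0) B)
    (hB : ∀ B', Merge B B' → Win (a ::ₘ b ::ₘ c ::ₘ 0) B')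
    (ha : FlipWin a (b ::ₘ c ::ₘ 0) B) (hb : FlipWin b (a ::ₘ c ::ₘ 0) B)
    (hc : FlipWin c (a ::ₘ b ::ₘ 0) B) : Lose (a ::ₘ b ::ₘ c ::ₘ 0) B := by
  refine .mk fun R' B' hs => ?_
  rcases hs with ⟨hm, rfl⟩ | ⟨hm, rfl⟩ | ⟨h, R₀, B₀, h1, rfl, hh⟩
  · rcases merge_cons hm with ⟨x, K, h, rfl⟩ | ⟨K, h, rfl⟩
    · rcases cons_eq_cons.1 h with ⟨rfl, rfl⟩ | ⟨-, K, h', rfl⟩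
      · exact hab
      · rcases cons_eq_cons.1 h' with ⟨rfl, rfl⟩ | ⟨-, K, h'', rfl⟩
        · exact hac
        · simp at h''
    · obtain rfl := merge_pair h
      rwa [cons_swap]
  · exact hB _ hm
  · rcases cons_eq_cons.1 h1 with ⟨rfl, rfl⟩ | ⟨-, K, h1', rfl⟩
    · have := ha.win rfl
      rcases hh with ⟨rfl, rfl⟩ | ⟨rfl, rfl⟩
      exacts [this.1, this.2]
    rcases cons_eq_cons.1 h1' with ⟨rfl, rfl⟩ | ⟨-, K, h1'', rfl⟩
    · have := hb.win rfl
      rcases hh with ⟨rfl, rfl⟩ | ⟨rfl, rfl⟩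
      exacts [this.1, this.2]
    rcases cons_eq_cons.1 h1'' with ⟨rfl, rfl⟩ | ⟨-, K, h1''', rfl⟩
    · have := hc.win rfl
      rcases hh with ⟨rfl, rfl⟩ | ⟨rfl, rfl⟩
      · rw [cons_swap a, cons_swap a, cons_swap b] at *
        exact this.1
      · exact this.2
    · simp at h1'''

theorem exists_cons_of_card {M : Multiset ℕ} (h : 1 ≤ card M) : ∃ x K, M = x ::ₘ K := by
  obtain ⟨x, hx⟩ := card_pos_iff_exists_mem.1 h
  exact ⟨x, exists_cons_of_mem hx⟩

/-- No stack of height `a` can be produced too often by merging stacks of heights `M`: at most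
`m` stacks have height `a / 2`, or some stack is higher than `a`. -/
def Sparse (m a : ℕ) (M : Multiset ℕ) : Prop :=
  a % 2 = 1 ∨ count (a / 2) M ≤ m ∨ ∃ x ∈ M, a < x

theorem Merge.sparse {m a : ℕ} {M N : Multiset ℕ} (h : Merge M N) (hs : Sparse m a M) :
    Sparse (m + 1) a N := by
  rcases hs with h1 | h1 | h1
  · exact .inl h1
  · have := h.count_le (a / 2)
    exact .inr (.inl (by omega))
  · exact .inr (.inr (h.exists_lt h1))

theorem lose_one_of_win {a : ℕ} {M : Multiset ℕ} (h0 : 0 ∉ M) (hc : card M % 2 = 1)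
    (hs : M.sum ≠ a) (ha : a ∉ M) (hh : Sparse 2 a M)
    (ih : ∀ N, card N < card M → 0 ∉ N → card N % 2 = 0 → card N ≠ 0 → N.sum ≠ a →
      count a N ≤ 2 → Sparse 3 a N → Win (a ::ₘ 0) N) : Lose (a ::ₘ 0) M := by
  refine lose_singleton ha fun N hN => ?_
  have h1 := hN.card
  have h2 := hN.count_le a
  rw [count_eq_zero_of_notMem ha] at h2
  have : card N ≠ 0 := by
    obtain ⟨x, y, K, rfl, rfl⟩ := hN
    simp
  exact ih N (by omega) (hN.zero_notMem h0) (by omega) this (by rwa [hN.sum]) (by omega)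
    (hN.sparse hh)

theorem exists_good_merge {a : ℕ} {M : Multiset ℕ} (h0 : 0 ∉ M) (hc : card M % 2 = 0)
    (hc0 : card M ≠ 0) (hs : M.sum ≠ a) (ha : count a M ≤ 2) (hh : Sparse 3 a M) :
    ∃ x y K, M = x ::ₘ y ::ₘ K ∧ x + y ≠ a ∧ a ∉ K ∧ Sparse 2 a ((x + y) ::ₘ K) := by
  by_cases haM : a ∈ M
  · obtain ⟨K, rfl⟩ := exists_cons_of_mem haM
    have big : ∀ d K', 0 < d → Sparse 2 a ((a + d) ::ₘ K') :=
      fun d K' hd => .inr (.inr ⟨_, mem_cons_self _ _, by omega⟩)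
    have ha0 : 0 < a := Nat.pos_of_ne_zero fun h => h0 (by simp [h])
    rw [count_cons_self] at ha
    by_cases haK : a ∈ K
    · obtain ⟨K, rfl⟩ := exists_cons_of_mem haK
      rw [count_cons_self] at ha
      exact ⟨a, a, K, rfl, by omega, count_eq_zero.1 (by omega), big _ _ ha0⟩
    · rw [card_cons] at hc
      obtain ⟨d, K, rfl⟩ := exists_cons_of_card (M := K) (by omega)
      simp only [mem_cons, not_or] at haK h0
      exact ⟨a, d, K, rfl, by omega, haK.2, big _ _ (by omega)⟩
  by_cases hb : ∃ b ∈ M, a < b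
  · obtain ⟨b, hbM, hab⟩ := hb
    obtain ⟨K, rfl⟩ := exists_cons_of_mem hbM
    rw [card_cons] at hc
    obtain ⟨d, K, rfl⟩ := exists_cons_of_card (M := K) (by omega)
    simp only [mem_cons, not_or] at haM
    exact ⟨b, d, K, rfl, by omega, haM.2.2, .inr (.inr ⟨_, mem_cons_self _ _, by omega⟩)⟩
  by_cases hM : a % 2 = 0 ∧ a / 2 ∈ M
  · have h3 : count (a / 2) M ≤ 3 := by
      rcases hh with h | h | h
      · omega
      · exact h
      · exact (hb h).elim
    obtain ⟨K, rfl⟩ := exists_cons_of_mem hM.2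
    rw [count_cons_self] at h3
    rw [card_cons] at hc
    obtain ⟨d, hd, hda⟩ : ∃ d ∈ K, d ≠ a / 2 := by
      by_contra! hne
      have hr := eq_replicate_card.2 hne
      have hcount : count (a / 2) K = card K := by rw [hr]; simp
      have : card K = 1 := by omega
      rw [this] at hr
      rw [hr] at hs
      simp at hs
      omega
    obtain ⟨K, rfl⟩ := exists_cons_of_mem hd
    rw [count_cons_of_ne (Ne.symm hda)] at h3
    simp only [mem_cons, not_or] at haM h0
    refine ⟨a / 2, d, K, rfl, by omega, haM.2.2, .inr (.inl ?_)⟩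
    rw [count_cons_of_ne (by omega)]
    omega
  · have key : ∀ x y K, M = x ::ₘ y ::ₘ K → x + y ≠ a →
        ∃ x y K, M = x ::ₘ y ::ₘ K ∧ x + y ≠ a ∧ a ∉ K ∧ Sparse 2 a ((x + y) ::ₘ K) := by
      rintro x y K rfl hxy
      simp only [mem_cons, not_or] at haM hM
      refine ⟨x, y, K, rfl, hxy, haM.2.2, ?_⟩
      by_cases ha2 : a % 2 = 1
      · exact .inl ha2
      · have : count (a / 2) K = 0 := count_eq_zero.2 fun h => hM ⟨by omega, .inr (.inr h)⟩
        have := count_cons (a / 2) (x + y) K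
        refine .inr (.inl ?_)
        split_ifs at this <;> omega
    obtain ⟨x, K, hxK⟩ := exists_cons_of_card (M := M) (by omega)
    have hcK : card M = card K + 1 := by simp [hxK]
    obtain ⟨y, K, rfl⟩ := exists_cons_of_card (M := K) (by omega)
    by_cases hxy : x + y = a
    · rw [card_cons] at hcK
      have hK : 1 ≤ card K := by
        by_contra! hK
        obtain rfl : K = 0 := by simpa using hK
        subst hxK
        simp at hs
        omega
      obtain ⟨z, K, rfl⟩ := exists_cons_of_card hK
      by_cases hxz : x + z = a
      · refine key y z (x ::ₘ K) (by rw [hxK]; simp [cons_swap]) fun hyz => hM ⟨by omega, ?_⟩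
        rw [show a / 2 = x by omega, hxK]
        simp
      · exact key x z (y ::ₘ K) (by rw [hxK]; simp [cons_swap]) hxz
    · exact key x y K hxK hxy

theorem win_one {a : ℕ} {M : Multiset ℕ} (h0 : 0 ∉ M) (hc : card M % 2 = 0)
    (hc0 : card M ≠ 0) (hs : M.sum ≠ a) (ha : count a M ≤ 2) (hh : Sparse 3 a M) :
    Win (a ::ₘ 0) M := by
  induction hn : card M using Nat.strong_induction_on generalizing M with
  | _ n ih =>
    subst hn
    obtain ⟨x, y, K, rfl, hxy, haK, hsp⟩ := exists_good_merge h0 hc hc0 hs ha hh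
    refine .blue rfl (lose_one_of_win ?_ ?_ ?_ ?_ hsp ?_)
    · simp only [mem_cons, not_or] at h0 ⊢; exact ⟨by omega, h0.2.2⟩
    · simp at hc ⊢; omega
    · simp at hs ⊢; omega
    · simp [haK, Ne.symm hxy]
    · intro N hN h1 h2 h3 h4 h5 h6
      exact ih _ (by simp at hN ⊢; omega) h1 h2 h3 h4 h5 h6 rfl

theorem lose_one {a : ℕ} {M : Multiset ℕ} (h0 : 0 ∉ M) (hc : card M % 2 = 1)
    (hs : M.sum ≠ a) (ha : a ∉ M) (hh : Sparse 2 a M) : Lose (a ::ₘ 0) M :=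
  lose_one_of_win h0 hc hs ha hh fun _ _ h0 hc hc0 hs ha hh => win_one h0 hc hc0 hs ha hh

theorem FlipWin.of_notMem {a : ℕ} {R B : Multiset ℕ} (h : a ∉ B) : FlipWin a R B := .inl h

theorem lose_two_of_lt {a b : ℕ} {M : Multiset ℕ} (h0 : 0 ∉ M) (hc : card M % 2 = 0)
    (ha : a ∉ M) (hb : b ∉ M) (hab : a + b ∉ M) (hlt : ∃ x ∈ M, a + b < x) :
    Lose (a ::ₘ b ::ₘ 0) M := by
  induction hn : card M using Nat.strong_induction_on generalizing M with
  | _ n ih =>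
    subst hn
    have hsum : M.sum ≠ a + b := by
      obtain ⟨x, hx, h⟩ := hlt
      have := le_sum_of_mem hx
      omega
    have hc0 : card M ≠ 0 := by
      rintro h
      obtain rfl : M = 0 := by simpa using h
      simp at hlt
    refine lose_pair (win_one h0 hc hc0 hsum ?_ (.inr (.inr hlt))) (fun N hN => ?_)
      (.of_notMem ha) (.of_notMem hb)
    · rw [count_eq_zero_of_notMem hab]; omega
    have hNc := hN.card
    have hN0 := hN.zero_notMem h0
    have hNlt := hN.exists_lt hlt
    by_cases hNs : a + b ∈ N
    · obtain ⟨x, y, K, rfl, rfl⟩ := hN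
      simp only [mem_cons, not_or] at ha hb hab hNs hN0
      have hs : a + b = x + y := hNs.resolve_right hab.2.2
      have hK : 1 ≤ card K := by
        by_contra! hK
        obtain rfl : K = 0 := by simpa using hK
        simp at hlt
        omega
      obtain ⟨d, K, rfl⟩ := exists_cons_of_card hK
      simp only [mem_cons, not_or] at ha hb hab hN0
      refine .blue rfl (ih (card ((x + y + d) ::ₘ K)) (by simp) ?_ ?_ ?_ ?_ ?_
        ⟨_, mem_cons_self _ _, by omega⟩ rfl)
      · simp only [mem_cons, not_or]; exact ⟨by omega, hN0.2.2⟩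
      · simp at hc ⊢; omega
      · simp only [mem_cons, not_or]; exact ⟨by omega, ha.2.2.2⟩
      · simp only [mem_cons, not_or]; exact ⟨by omega, hb.2.2.2⟩
      · simp only [mem_cons, not_or]; exact ⟨by omega, hab.2.2.2⟩
    · exact .red rfl (lose_one hN0 (by omega) (by rwa [hN.sum]) hNs (.inr (.inr hNlt)))

theorem lose_two_of_merge {a b : ℕ} {M : Multiset ℕ} (h0 : 0 ∉ M) (hc : card M % 2 = 0)
    (hc0 : card M ≠ 0) (hs : M.sum ≠ a + b) (hab : a + b ∉ M)
    (hh : Sparse 3 (a + b) M) (hm : ∀ N, Merge M N → Sparse 2 (a + b) N)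
    (hK : ∀ x y K, M = x ::ₘ y ::ₘ K → x + y = a + b → a ∉ K ∧ b ∉ K)
    (ha : FlipWin a (b ::ₘ 0) M) (hb : FlipWin b (a ::ₘ 0) M) :
    Lose (a ::ₘ b ::ₘ 0) M := by
  refine lose_pair (win_one h0 hc hc0 hs ?_ hh) (fun N hN => ?_) ha hb
  · rw [count_eq_zero_of_notMem hab]; omega
  have hNc := hN.card
  have hN0 := hN.zero_notMem h0
  by_cases hNs : a + b ∈ N
  · obtain ⟨x, y, K, rfl, rfl⟩ := hN
    simp only [mem_cons, not_or] at hab hNs hN0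
    have hxy : a + b = x + y := hNs.resolve_right hab.2.2
    obtain ⟨haK, hbK⟩ := hK x y K rfl hxy.symm
    have hK : 1 ≤ card K := by
      by_contra! hK
      obtain rfl : K = 0 := by simpa using hK
      simp at hs
      omega
    obtain ⟨d, K, rfl⟩ := exists_cons_of_card hK
    simp only [mem_cons, not_or] at haK hbK hab hN0
    refine .blue rfl (lose_two_of_lt ?_ ?_ ?_ ?_ ?_ ⟨_, mem_cons_self _ _, by omega⟩)
    · simp only [mem_cons, not_or]; exact ⟨by omega, hN0.2.2⟩
    · simp at hc ⊢; omega
    · simp only [mem_cons, not_or]; exact ⟨by omega, haK.2⟩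
    · simp only [mem_cons, not_or]; exact ⟨by omega, hbK.2⟩
    · simp only [mem_cons, not_or]; exact ⟨by omega, hab.2.2.2⟩
  · exact .red rfl (lose_one hN0 (by omega) (by rwa [hN.sum]) hNs (hm _ hN))

theorem Sparse.mono {m n a : ℕ} {M : Multiset ℕ} (h : Sparse m a M) (hmn : m ≤ n) :
    Sparse n a M := by
  rcases h with h | h | h
  · exact .inl h
  · exact .inr (.inl (h.trans hmn))
  · exact .inr (.inr h)

/-- No blue stack has the height of one of the two red stacks `a`, `b`. -/
theorem lose_two {a b : ℕ} {M : Multiset ℕ} (h0 : 0 ∉ M) (hc : card M % 2 = 0)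
    (hc0 : card M ≠ 0) (hs : M.sum ≠ a + b) (hab : a + b ∉ M) (hh : Sparse 1 (a + b) M)
    (ha : a ∉ M) (hb : b ∉ M) : Lose (a ::ₘ b ::ₘ 0) M :=
  lose_two_of_merge h0 hc hc0 hs hab (hh.mono (by omega)) (fun _ h => h.sparse hh)
    (by rintro x y K rfl -; simp at ha hb; tauto) (.of_notMem ha) (.of_notMem hb)

/-- Blue stacks may match red ones, but no two of them add up to the total of the red ones. -/
theorem lose_two_of_add_ne {a b : ℕ} {M : Multiset ℕ} (h0 : 0 ∉ M) (hc : card M % 2 = 0)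
    (hc0 : card M ≠ 0) (hs : M.sum ≠ a + b) (hab : a + b ∉ M) (hh : Sparse 1 (a + b) M)
    (hne : ∀ x ∈ M, ∀ y ∈ M, x + y ≠ a + b)
    (ha : FlipWin a (b ::ₘ 0) M) (hb : FlipWin b (a ::ₘ 0) M) : Lose (a ::ₘ b ::ₘ 0) M :=
  lose_two_of_merge h0 hc hc0 hs hab (hh.mono (by omega)) (fun _ h => h.sparse hh)
    (by rintro x y K rfl h; exact (hne x (by simp) y (by simp) h).elim) ha hb

theorem card_add_le_sum {a : ℕ} {M : Multiset ℕ} (h0 : 0 ∉ M) (ha : a ∈ M) :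
    a + card M ≤ M.sum + 1 := by
  obtain ⟨K, rfl⟩ := exists_cons_of_mem ha
  have : card K • 1 ≤ K.sum := card_nsmul_le_sum fun x hx =>
    Nat.one_le_iff_ne_zero.2 fun h => h0 (by simp [← h, hx])
  simp at this ⊢
  omega

/-- Two blue stacks may add up to the total of the red ones, but the other blue stacks are then
too small to match a red one. -/
theorem lose_two_of_sum_lt {a b : ℕ} {M : Multiset ℕ} (h0 : 0 ∉ M) (hc : card M % 2 = 0)
    (hc0 : card M ≠ 0) (hs : M.sum ≠ a + b) (hab : a + b ∉ M) (hh : Sparse 1 (a + b) M)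
    (hla : M.sum + 3 < a + b + a + card M) (hlb : M.sum + 3 < a + b + b + card M)
    (ha : FlipWin a (b ::ₘ 0) M) (hb : FlipWin b (a ::ₘ 0) M) : Lose (a ::ₘ b ::ₘ 0) M := by
  refine lose_two_of_merge h0 hc hc0 hs hab (hh.mono (by omega)) (fun _ h => h.sparse hh)
    ?_ ha hb
  rintro x y K rfl h
  simp only [mem_cons, not_or] at h0
  simp at hla hlb
  refine ⟨fun h' => ?_, fun h' => ?_⟩ <;> have := card_add_le_sum h0.2.2 h' <;> omega

theorem win_two {a b : ℕ} {M : Multiset ℕ} (h0 : 0 ∉ M) (hc : card M % 2 = 1)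
    (hs : M.sum ≠ a + b) (ha : a + b ∉ M) (hh : Sparse 2 (a + b) M) : Win (a ::ₘ b ::ₘ 0) M :=
  .red rfl (lose_one h0 hc hs ha hh)

attribute [local simp] Sparse count_cons count_singleton count_replicate mem_replicate

theorem lose_two_two {a c n : ℕ} (ha : a % 2 = 0) (hc : c % 2 = 0) (ha4 : 4 ≤ a) (hc2 : 2 ≤ c)
    (hn : n % 2 = 0) (h : n + c = a + 2) :
    Lose (2 ::ₘ a ::ₘ 0) (2 ::ₘ c ::ₘ replicate n 1) := by
  have h2 : FlipWin 2 (a ::ₘ 0) (2 ::ₘ c ::ₘ replicate n 1) :=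
    .inr ⟨_, rfl, by apply win_two <;> simp <;> lia, by apply win_one <;> simp <;> lia⟩
  have ha : FlipWin a (2 ::ₘ 0) (2 ::ₘ c ::ₘ replicate n 1) := by
    by_cases hac : a = c
    · subst hac
      exact .inr ⟨_, cons_swap _ _ _, by apply win_two <;> simp <;> lia,
        by apply win_one <;> simp <;> lia⟩
    · refine .of_notMem ?_
      simp; lia
  rcases Nat.eq_zero_or_pos n with rfl | hn0
  · refine lose_pair (by apply win_one <;> simp <;> lia) (fun N hN => ?_) h2 ha
    obtain rfl := merge_pair hN
    apply win_two <;> simp <;> lia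
  · apply lose_two_of_sum_lt _ _ _ _ _ _ _ _ h2 ha <;> simp <;> lia

theorem win_two_one {a c k : ℕ} (ha : a % 2 = 0) (hc : c % 2 = 0) (ha2 : 2 ≤ a) (hc2 : 2 ≤ c)
    (hk : k % 2 = 1) (hac : 6 ≤ a + c) (hk1 : k = 1 → 8 ≤ a + c) :
    Win (2 ::ₘ 1 ::ₘ a ::ₘ 0) (c ::ₘ replicate k 1) := by
  by_cases h : k + c = a + 3
  · refine .flipBlue (a := 1) (R₀ := 2 ::ₘ a ::ₘ 0) (B₀ := c ::ₘ replicate (k - 1) 1)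
      (by simp only [← singleton_add]; abel) ?_ (lose_two_two ?_ ?_ ?_ ?_ ?_ ?_)
    · rw [replicate_one_eq_cons (by omega), cons_swap]
    all_goals omega
  by_cases hc4 : c = 2
  · refine .red (a := 2) (b := 1) rfl ?_
    apply lose_two <;> simp <;> lia
  · refine .red (a := 1) (b := a) (R₀ := 2 ::ₘ 0) (by simp only [← singleton_add]; abel) ?_
    apply lose_two <;> simp <;> lia

theorem lose_odd_one {a c n : ℕ} (ha : a % 2 = 0) (hc : c % 2 = 0) (ha4 : 4 ≤ a) (hc2 : 2 ≤ c)
    (hn : n % 2 = 0) (hn2 : 2 ≤ n) (h : n + c = a + 2) :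
    Lose ((1 + a) ::ₘ 1 ::ₘ 0) (2 ::ₘ c ::ₘ replicate n 1) := by
  have ha : FlipWin (1 + a) (1 ::ₘ 0) (2 ::ₘ c ::ₘ replicate n 1) := by
    refine .of_notMem ?_
    simp; lia
  have h1 : FlipWin 1 ((1 + a) ::ₘ 0) (2 ::ₘ c ::ₘ replicate n 1) := by
    refine .inr ⟨2 ::ₘ c ::ₘ replicate (n - 1) 1, ?_, ?_, ?_⟩
    · rw [replicate_one_eq_cons (by omega)]
      simp [cons_swap]
    · refine .flipBlue (a := 2) rfl rfl ?_
      apply lose_one <;> simp <;> lia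
    · apply win_one <;> simp <;> lia
  rcases (by omega : n = 2 ∨ 3 < n) with rfl | hn3
  · refine lose_pair (by apply win_one <;> simp <;> lia) (fun N hN => ?_) ha h1
    rcases merge_cons_cons_replicate hN with rfl | ⟨-, rfl⟩ | ⟨-, rfl⟩ | ⟨-, rfl⟩
    · refine .flipBlue (a := 1) (R₀ := (1 + a) ::ₘ 0) (B₀ := (2 + c) ::ₘ 1 ::ₘ 0)
        (by simp only [← singleton_add]; abel)
        (by simp only [replicate_succ, replicate_zero, ← singleton_add]; abel) ?_
      apply lose_one <;> simp <;> lia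
    all_goals apply win_two <;> simp <;> lia
  · apply lose_two_of_sum_lt _ _ _ _ _ _ _ _ ha h1 <;> simp <;> lia

theorem win_odd_one_one {a c k : ℕ} (ha : a % 2 = 0) (hc : c % 2 = 0) (ha2 : 2 ≤ a) (hc2 : 2 ≤ c)
    (hk : k % 2 = 1) (hk3 : 3 ≤ k) (hac : 6 ≤ a + c) :
    Win ((1 + a) ::ₘ 1 ::ₘ 1 ::ₘ 0) (c ::ₘ replicate k 1) := by
  by_cases h : k + c = a + 3
  · refine .flipBlue (a := 1) (R₀ := (1 + a) ::ₘ 1 ::ₘ 0) (B₀ := c ::ₘ replicate (k - 1) 1)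
      (by simp only [← singleton_add]; abel) ?_ (lose_odd_one ?_ ?_ ?_ ?_ ?_ ?_ ?_)
    · rw [replicate_one_eq_cons (by omega), cons_swap]
    all_goals omega
  by_cases hc4 : c = 2
  · subst hc4
    by_cases hka : k + 3 = a ∨ k = a + 5
    · refine .red (a := 1 + a) (b := 1) rfl ?_
      refine lose_two_of_add_ne ?_ ?_ ?_ ?_ ?_ ?_ ?_ ?_ (.inr ⟨2 ::ₘ replicate (k - 1) 1,
        ?_, ?_, ?_⟩)
      rotate_left 8
      · rw [replicate_one_eq_cons (by omega)]
        simp [cons_swap]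
      · apply win_two <;> simp <;> lia
      · apply win_one <;> simp <;> lia
      · simp
      · simp; lia
      · simp
      · simp; lia
      · simp
      · simp; lia
      · simp; lia
      · refine .of_notMem ?_
        simp; lia
    · refine .red (a := 1) (b := 1) (R₀ := (1 + a) ::ₘ 0) (by simp only [← singleton_add]; abel) ?_
      refine lose_two_of_add_ne ?_ ?_ ?_ ?_ ?_ ?_ ?_ (.inr ⟨_, rfl, ?_, ?_⟩) ?_
      rotate_left 7
      · apply win_two <;> simp <;> lia
      · apply win_one <;> simp <;> lia
      · refine .of_notMem ?_
        simp; lia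
      all_goals simp <;> lia
  · refine .red (a := 1) (b := 1) (R₀ := (1 + a) ::ₘ 0) (by simp only [← singleton_add]; abel) ?_
    apply lose_two <;> simp <;> lia

theorem lose_one_even {a c n : ℕ} (ha : a % 2 = 0) (hc : c % 2 = 0) (hc2 : 2 ≤ c)
    (hn : n % 2 = 1) (h : n + c + 1 = a) (h4 : 6 ≤ a) :
    Lose (1 ::ₘ a ::ₘ 0) (2 ::ₘ 2 ::ₘ c ::ₘ replicate n 1) := by
  have ha : FlipWin a (1 ::ₘ 0) (2 ::ₘ 2 ::ₘ c ::ₘ replicate n 1) := by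
    refine .of_notMem ?_
    simp; lia
  have h1 : FlipWin 1 (a ::ₘ 0) (2 ::ₘ 2 ::ₘ c ::ₘ replicate n 1) := by
    refine .inr ⟨2 ::ₘ 2 ::ₘ c ::ₘ replicate (n - 1) 1, ?_, ?_, ?_⟩
    · rw [replicate_one_eq_cons (by omega)]
      simp only [← singleton_add]; abel
    · refine .flipBlue (a := 2) rfl rfl ?_
      apply lose_one <;> simp <;> lia
    · apply win_one <;> simp <;> lia
  apply lose_two_of_add_ne _ _ _ _ _ _ _ h1 ha <;> simp <;> lia

theorem win_two_of_pair {a c m : ℕ} (ha : a % 2 = 0) (hc : c % 2 = 0) (ha2 : 2 ≤ a) (hc2 : 2 ≤ c)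
    (hm : m % 2 = 0) (hm2 : 2 ≤ m) (h : m + c ≠ a + 2) :
    Win (2 ::ₘ a ::ₘ 0) (c ::ₘ replicate m 1) := by
  by_cases hca : c = a + 2
  · refine .blue (a := c) (b := 1) (B₀ := replicate (m - 1) 1)
      (by rw [replicate_one_eq_cons (by omega)]) ?_
    apply lose_two_of_lt <;> simp <;> lia
  · apply win_two <;> simp <;> lia

theorem win_odd_one {a c m : ℕ} (ha : a % 2 = 0) (hc : c % 2 = 0) (ha2 : 2 ≤ a) (hc2 : 2 ≤ c)
    (hm : m % 2 = 0) (hm2 : 2 ≤ m) (h : m + c ≠ a + 2) :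
    Win ((1 + a) ::ₘ 1 ::ₘ 0) (c ::ₘ replicate m 1) := by
  by_cases hca : c = a + 2
  · refine .flipBlue (a := 1) (R₀ := (1 + a) ::ₘ 0) (B₀ := c ::ₘ replicate (m - 1) 1)
      (cons_swap _ _ _) (by rw [replicate_one_eq_cons (by omega), cons_swap]) ?_
    apply lose_one <;> simp <;> lia
  · apply win_two <;> simp <;> lia

theorem win_one_one_double {a m : ℕ} (ha : a % 2 = 0) (ha4 : 4 ≤ a) (hm : m % 2 = 0)
    (hm2 : 2 ≤ m) : Win (2 * a ::ₘ 1 ::ₘ 1 ::ₘ 0) (replicate m 1) := by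
  by_cases h : m = 2 * a + 2
  · refine .flipBlue (a := 1) (R₀ := 2 * a ::ₘ 1 ::ₘ 0) (cons_swap _ _ _)
      (replicate_one_eq_cons (by omega)) ?_
    have h1 : FlipWin 1 (2 * a ::ₘ 0) (2 ::ₘ replicate (m - 1) 1) := by
      refine .inr ⟨2 ::ₘ replicate (m - 2) 1, ?_, ?_, ?_⟩
      · rw [replicate_one_eq_cons (by omega), cons_swap]; rfl
      · refine .flipBlue (a := 2) rfl rfl ?_
        apply lose_one <;> simp <;> lia
      · apply win_one <;> simp <;> lia
    have h2 : FlipWin (2 * a) (1 ::ₘ 0) (2 ::ₘ replicate (m - 1) 1) := by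
      refine .of_notMem ?_
      simp; lia
    apply lose_two_of_add_ne _ _ _ _ _ _ _ h2 h1 <;> simp <;> lia
  · refine .red (a := 1) (b := 1) (R₀ := 2 * a ::ₘ 0) (by simp only [← singleton_add]; abel) ?_
    apply lose_two <;> simp <;> lia

theorem lose_one_one {a c m : ℕ} (ha : a % 2 = 0) (hc : c % 2 = 0) (ha2 : 2 ≤ a) (hc2 : 2 ≤ c)
    (hm : m % 2 = 0) (hm2 : 2 ≤ m) (hac : 8 ≤ a + c) (h : m + c ≠ a + 2) :
    Lose (1 ::ₘ 1 ::ₘ a ::ₘ 0) (c ::ₘ replicate m 1) := by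
  induction m using Nat.strong_induction_on generalizing c with
  | _ m ih =>
    have h1 : FlipWin 1 (1 ::ₘ a ::ₘ 0) (c ::ₘ replicate m 1) := by
      refine .inr ⟨c ::ₘ replicate (m - 1) 1, ?_, ?_, ?_⟩
      · rw [replicate_one_eq_cons (by omega), cons_swap]
      · apply win_two_one <;> omega
      · by_cases hmc : m + c = a
        · refine .flipBlue (a := 1) (R₀ := a ::ₘ 0) (B₀ := 2 ::ₘ c ::ₘ replicate (m - 2) 1)
            rfl ?_ ?_
          · rw [replicate_one_eq_cons (by omega), Nat.sub_sub]
            simp only [← singleton_add]; abel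
          · apply lose_one <;> simp <;> lia
        · apply win_two <;> simp <;> lia
    refine lose_triple (win_two_of_pair ha hc ha2 hc2 hm hm2 h)
      (win_odd_one ha hc ha2 hc2 hm hm2 h) (win_odd_one ha hc ha2 hc2 hm hm2 h)
      (fun N hN => ?_) h1 h1 ?_
    · rcases (by omega : m = 2 ∨ 4 ≤ m) with rfl | hm4
      · have h11 : 1 ::ₘ 1 ::ₘ a ::ₘ 0 = a ::ₘ replicate 2 1 := by
          simp only [replicate_succ, replicate_zero, ← singleton_add]; abel
        rw [h11]
        rcases merge_cons_replicate hN with ⟨-, rfl⟩ | ⟨-, rfl⟩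
        · rw [add_comm c]
          exact (win_odd_one (m := 2) hc ha hc2 ha2 rfl le_rfl (by omega)).symm
        · exact (win_two_of_pair (m := 2) hc ha hc2 ha2 rfl le_rfl (by omega)).symm
      · rcases merge_cons_replicate hN with ⟨-, rfl⟩ | ⟨-, rfl⟩
        · refine .blue (a := c + 1) (b := 1) (B₀ := replicate (m - 2) 1)
            (by rw [replicate_one_eq_cons (by omega)]; rfl) ?_
          apply ih <;> omega
        · refine .blue rfl ?_
          apply ih <;> omega
    · by_cases hca : a = c
      · subst hca
        refine .inr ⟨_, rfl, win_one_one_double ha (by omega) hm hm2, ?_⟩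
        apply win_two <;> simp <;> lia
      · refine .of_notMem ?_
        simp; lia

theorem lose_one_one_four : Lose (1 ::ₘ 1 ::ₘ 4 ::ₘ 0) (4 ::ₘ replicate 2 1) := by
  have h5 : Win ((1 + 4) ::ₘ 1 ::ₘ 0) (4 ::ₘ replicate 2 1) := by
    refine .flipBlue (a := 1) (R₀ := (1 + 4) ::ₘ 0) (B₀ := 4 ::ₘ replicate 1 1)
      (cons_swap _ _ _) (cons_swap 4 1 (replicate 1 1)) ?_
    apply lose_one <;> simp
  have h1 : FlipWin 1 (1 ::ₘ 4 ::ₘ 0) (4 ::ₘ replicate 2 1) := by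
    refine .inr ⟨4 ::ₘ replicate 1 1, cons_swap 4 1 (replicate 1 1), ?_, ?_⟩
    · apply win_two_one <;> omega
    · apply win_two <;> simp
  have h2 : Win (2 ::ₘ 4 ::ₘ 0) (4 ::ₘ replicate 2 1) := by
    refine .flipBlue (a := 4) (R₀ := 2 ::ₘ 0) (cons_swap _ _ _) rfl ?_
    apply lose_one <;> simp
  refine lose_triple h2 h5 h5 (fun N hN => ?_) h1 h1 (.inr ⟨_, rfl, ?_, ?_⟩)
  · have h11 : 1 ::ₘ 1 ::ₘ 4 ::ₘ 0 = 4 ::ₘ replicate 2 1 := by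
      simp only [replicate_succ, replicate_zero, ← singleton_add]; abel
    rw [h11]
    rcases merge_cons_replicate hN with ⟨-, rfl⟩ | ⟨-, rfl⟩
    · exact h5.symm
    · exact h2.symm
  · exact win_one_one_double rfl le_rfl rfl le_rfl
  · apply win_two <;> simp

theorem lose_two_four {a c n : ℕ} (ha : a % 2 = 0) (hc : c % 2 = 0) (hc4 : 4 ≤ c)
    (hn : n % 2 = 0) (hn2 : 2 ≤ n) (h : n + c = a + 2) :
    Lose (2 ::ₘ a ::ₘ 0) (4 ::ₘ c ::ₘ replicate n 1) := by
  have h2 : FlipWin 2 (a ::ₘ 0) (4 ::ₘ c ::ₘ replicate n 1) := by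
    refine .of_notMem ?_
    simp; lia
  have ha : FlipWin a (2 ::ₘ 0) (4 ::ₘ c ::ₘ replicate n 1) := by
    by_cases hac : a = c
    · subst hac
      exact .inr ⟨_, cons_swap _ _ _, by apply win_two <;> simp <;> lia,
        by apply win_one <;> simp <;> lia⟩
    · refine .of_notMem ?_
      simp; lia
  refine lose_two_of_merge ?_ ?_ ?_ ?_ ?_ ?_ (fun N hN => ?_) (fun x y K hM hxy => ?_) h2 ha
  rotate_left 6
  · rcases merge_cons_cons_replicate hN with rfl | ⟨-, rfl⟩ | ⟨-, rfl⟩ | ⟨-, rfl⟩ <;> simp <;> lia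
  · refine ⟨fun h' => ?_, fun h' => ?_⟩
    · have : 2 ∈ 4 ::ₘ c ::ₘ replicate n 1 := hM ▸ by simp [h']
      simp at this; lia
    · have h3 : a ∈ 4 ::ₘ c ::ₘ replicate n 1 := hM ▸ by simp [h']
      have h4 : 2 + a ∈ (x + y) ::ₘ K := by simp [hxy]
      rcases merge_cons_cons_replicate ⟨x, y, K, hM, rfl⟩ with h | ⟨-, h⟩ | ⟨-, h⟩ | ⟨-, h⟩ <;>
        rw [h] at h4 <;> simp at h3 h4 <;> lia
  all_goals simp <;> lia

theorem lose_one_two {a c m : ℕ} (ha : a % 2 = 0) (hc : c % 2 = 0) (hc4 : 4 ≤ c)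
    (hm : m % 2 = 1) (hm3 : 3 ≤ m) (h : m + c = a + 3) :
    Lose (1 ::ₘ 2 ::ₘ a ::ₘ 0) (2 ::ₘ c ::ₘ replicate m 1) := by
  refine lose_triple ?_ ?_ ?_ (fun N hN => ?_) (.inr ⟨2 ::ₘ c ::ₘ replicate (m - 1) 1, ?_, ?_, ?_⟩)
    (.inr ⟨_, rfl, ?_, ?_⟩) ?_
  · apply win_two <;> simp <;> lia
  · apply win_two <;> simp <;> lia
  · apply win_two <;> simp <;> lia
  · refine .red (a := 1) (b := a) (R₀ := 2 ::ₘ 0) (by simp only [← singleton_add]; abel) ?_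
    rcases merge_cons_cons_replicate hN with rfl | ⟨-, rfl⟩ | ⟨-, rfl⟩ | ⟨-, rfl⟩
    · apply lose_two <;> simp <;> lia
    · apply lose_two <;> simp <;> lia
    · have h2 : FlipWin 2 ((1 + a) ::ₘ 0) ((c + 1) ::ₘ 2 ::ₘ replicate (m - 1) 1) := by
        refine .inr ⟨_, cons_swap _ _ _, ?_, ?_⟩
        · apply win_two <;> simp <;> lia
        · apply win_one <;> simp <;> lia
      have ha : FlipWin (1 + a) (2 ::ₘ 0) ((c + 1) ::ₘ 2 ::ₘ replicate (m - 1) 1) := by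
        by_cases hac : a = c
        · subst hac
          rw [add_comm]
          refine .inr ⟨_, rfl, ?_, ?_⟩
          · apply win_two <;> simp <;> lia
          · apply win_one <;> simp <;> lia
        · refine .of_notMem ?_
          simp; lia
      apply lose_two_of_sum_lt _ _ _ _ _ _ _ _ ha h2 <;> simp <;> lia
    · have h2 : FlipWin 2 ((1 + a) ::ₘ 0) (2 ::ₘ 2 ::ₘ c ::ₘ replicate (m - 2) 1) := by
        refine .inr ⟨_, rfl, ?_, ?_⟩
        · apply win_two <;> simp <;> lia
        · apply win_one <;> simp <;> lia
      have ha : FlipWin (1 + a) (2 ::ₘ 0) (2 ::ₘ 2 ::ₘ c ::ₘ replicate (m - 2) 1) := by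
        refine .of_notMem ?_
        simp; lia
      apply lose_two_of_sum_lt _ _ _ _ _ _ _ _ ha h2 <;> simp <;> lia
  · rw [replicate_one_eq_cons (by omega)]
    simp only [← singleton_add]; abel
  · refine .flipBlue (a := 2) rfl rfl ?_
    apply lose_two_four <;> omega
  · apply win_two <;> simp <;> lia
  · refine .red (a := 1) (b := a) (R₀ := 4 ::ₘ 0) (by simp only [← singleton_add]; abel) ?_
    have h4 : FlipWin 4 ((1 + a) ::ₘ 0) (c ::ₘ replicate m 1) := by
      by_cases hc4 : c = 4
      · subst hc4
        refine .inr ⟨_, rfl, ?_, ?_⟩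
        · apply win_two <;> simp <;> lia
        · apply win_one <;> simp <;> lia
      · refine .of_notMem ?_
        simp; lia
    have ha : FlipWin (1 + a) (4 ::ₘ 0) (c ::ₘ replicate m 1) := by
      refine .of_notMem ?_
      simp; lia
    apply lose_two_of_sum_lt _ _ _ _ _ _ _ _ ha h4 <;> simp <;> lia
  · apply win_two <;> simp <;> lia
  · by_cases hac : a = c
    · subst hac
      refine .inr ⟨_, cons_swap _ _ _, ?_, ?_⟩
      · refine .red (a := 1) (b := 2) (R₀ := 2 * a ::ₘ 0) (by simp only [← singleton_add]; abel) ?_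
        apply lose_two <;> simp <;> lia
      · apply win_two <;> simp <;> lia
    · refine .of_notMem ?_
      simp; lia

theorem win_flipped_blue {a c n : ℕ} (ha : a % 2 = 0) (hc : c % 2 = 0) (ha2 : 2 ≤ a) (hc2 : 2 ≤ c)
    (hn : n % 2 = 0) (hn2 : 2 ≤ n) (hac : 6 ≤ a + c) :
    Win (1 ::ₘ 1 ::ₘ a ::ₘ 0) (2 ::ₘ c ::ₘ replicate n 1) := by
  by_cases h : n + c = a
  · by_cases ha4 : a = 4
    · obtain rfl : n = 2 := by omega
      obtain rfl : c = 2 := by omega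
      subst ha4
      exact .blue rfl lose_one_one_four
    · refine .flipBlue (a := 1) (B₀ := 2 ::ₘ c ::ₘ replicate (n - 1) 1) rfl ?_
        (lose_one_even ?_ ?_ ?_ ?_ ?_ ?_)
      · rw [replicate_one_eq_cons (by omega)]
        simp only [← singleton_add]; abel
      all_goals omega
  · refine .blue rfl (lose_one_one ?_ ?_ ?_ ?_ ?_ ?_ ?_ ?_) <;> omega

theorem win_flipped_red {a c n : ℕ} (ha : a % 2 = 0) (hc : c % 2 = 0) (ha2 : 2 ≤ a) (hc2 : 2 ≤ c)
    (hn : n % 2 = 0) (hn2 : 2 ≤ n) (hac : 6 ≤ a + c) :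
    Win (2 ::ₘ 1 ::ₘ 1 ::ₘ a ::ₘ 0) (c ::ₘ replicate n 1) := by
  by_cases h : n + c = a + 4
  · by_cases hn2 : n = 2
    · subst hn2
      convert (win_flipped_blue (n := 2) hc ha hc2 ha2 rfl le_rfl (by omega)).symm using 1
      · simp only [replicate_succ, replicate_zero, ← singleton_add]; abel
      · simp only [replicate_succ, replicate_zero, ← singleton_add]; abel
    by_cases hc2 : c = 2
    · subst hc2
      refine .flipBlue (a := 2) rfl rfl (lose_one_one ?_ ?_ ?_ ?_ ?_ ?_ ?_ ?_) <;> omega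
    · refine .flipBlue (a := 1) (R₀ := 1 ::ₘ 2 ::ₘ a ::ₘ 0) (B₀ := c ::ₘ replicate (n - 1) 1)
        (by simp only [← singleton_add]; abel) ?_ (lose_one_two ?_ ?_ ?_ ?_ ?_ ?_)
      · rw [replicate_one_eq_cons (by omega), cons_swap]
      all_goals omega
  · refine .red (a := 2) (b := a) (R₀ := 1 ::ₘ 1 ::ₘ 0) (by simp only [← singleton_add]; abel) ?_
    have : 1 ::ₘ 1 ::ₘ (2 + a) ::ₘ 0 = (2 + a) ::ₘ 1 ::ₘ 1 ::ₘ 0 := by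
      simp only [← singleton_add]; abel
    rw [← this]
    apply lose_one_one <;> omega

theorem cons_replicate_eq_cons {c n h : ℕ} {K : Multiset ℕ}
    (hK : c ::ₘ replicate n 1 = h ::ₘ K) : (h = c ∧ K = replicate n 1) ∨
      (1 ≤ n ∧ h = 1 ∧ K = c ::ₘ replicate (n - 1) 1) := by
  rcases cons_eq_cons.1 hK with ⟨rfl, rfl⟩ | ⟨-, L, h', rfl⟩
  · exact .inl ⟨rfl, rfl⟩
  · obtain ⟨h1, rfl, rfl⟩ := replicate_eq_cons h'
    exact .inr ⟨h1, rfl, rfl⟩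

/-- Three red and `k` blue singletons, one even red and one even blue stack. -/
theorem lose_three_of_odd {a c k : ℕ} (ha : a % 2 = 0) (hc : c % 2 = 0) (ha2 : 2 ≤ a)
    (hc2 : 2 ≤ c) (hk : k % 2 = 1) (hk3 : 3 ≤ k) (hac : 6 ≤ a + c) :
    Lose (a ::ₘ replicate 3 1) (c ::ₘ replicate k 1) := by
  induction k using Nat.strong_induction_on generalizing a c with
  | _ k ih =>
  have e1 : ∀ a, 2 ::ₘ a ::ₘ replicate 1 1 = 2 ::ₘ 1 ::ₘ a ::ₘ 0 := fun a => by
    simp only [replicate_succ, replicate_zero, ← singleton_add]; abel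
  have e2 : ∀ a, (a + 1) ::ₘ replicate 2 1 = (1 + a) ::ₘ 1 ::ₘ 1 ::ₘ 0 := fun a => by
    rw [add_comm a]; rfl
  have e3 : ∀ a, 1 ::ₘ 1 ::ₘ a ::ₘ 0 = a ::ₘ replicate 2 1 := fun a => by
    simp only [replicate_succ, replicate_zero, ← singleton_add]; abel
  refine .mk fun R' B' hs => ?_
  rcases hs with ⟨hm, rfl⟩ | ⟨hm, rfl⟩ | ⟨h, R₀, B₀, h1, h2, hh⟩
  · rcases merge_cons_replicate hm with ⟨-, rfl⟩ | ⟨-, rfl⟩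
    · rw [e2]
      apply win_odd_one_one <;> omega
    · rw [e1]
      apply win_two_one <;> omega
  · rcases (by omega : k = 3 ∨ 5 ≤ k) with rfl | hk5
    · rcases merge_cons_replicate hm with ⟨-, rfl⟩ | ⟨-, rfl⟩
      · rw [e2]
        refine .symm ?_
        apply win_odd_one_one <;> omega
      · rw [e1]
        refine .symm ?_
        apply win_two_one <;> omega
    · rcases merge_cons_replicate hm with ⟨-, rfl⟩ | ⟨-, rfl⟩
      · refine .blue (a := c + 1) (b := 1) (B₀ := replicate (k - 2) 1)
          (by rw [replicate_one_eq_cons (by omega)]; rfl) ?_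
        apply ih <;> omega
      · refine .blue rfl ?_
        apply ih <;> omega
  · rcases cons_replicate_eq_cons h1 with ⟨rfl, rfl⟩ | ⟨-, rfl, rfl⟩ <;>
      rcases cons_replicate_eq_cons h2 with ⟨rfl, rfl⟩ | ⟨-, hh1, rfl⟩
    · rcases hh with ⟨rfl, rfl⟩ | ⟨rfl, rfl⟩
      · by_cases hka : k = 2 * h + 1
        · refine .blue (a := 1) (b := 1) (B₀ := replicate (k - 2) 1) ?_
            (ih _ ?_ ?_ ?_ ?_ ?_ ?_ ?_ ?_)
          · rw [replicate_one_eq_cons (by omega), replicate_one_eq_cons (by omega), Nat.sub_sub]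
          all_goals omega
        · refine .flipBlue (a := 1) (R₀ := 2 * h ::ₘ replicate 2 1) (B₀ := replicate (k - 1) 1)
            (cons_swap _ _ (replicate 2 1)) (replicate_one_eq_cons (by omega)) ?_
          rw [← e3]
          apply lose_one_one <;> omega
      · refine .flipRed (a := 1) (R₀ := replicate 2 1) (B₀ := 2 * h ::ₘ replicate (k - 1) 1)
          rfl ?_ ?_
        · rw [replicate_one_eq_cons (by omega), cons_swap]
        · rw [← e3]
          apply lose_one_one <;> omega
    · omega
    · omega
    · rcases hh with ⟨rfl, rfl⟩ | ⟨rfl, rfl⟩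
      · rw [← e3]
        apply win_flipped_red <;> omega
      · rw [← e3]
        apply win_flipped_blue <;> omega

end Babylon

/-- Lemma 4: every position `⟨3, k; 2u; 2v⟩` with `k ≥ 3` odd, `u, v ≥ 1` and
`u + v ≥ 3` is not a first-player win. -/
theorem lemma4 (k u v : ℕ) (R B : Stack)
    (hk : 3 ≤ k) (hkodd : Odd k)
    (hu : 1 ≤ u) (hv : 1 ≤ v) (huv : 3 ≤ u + v)
    (hR : R.head? = some true) (hRlen : R.length = 2 * u)
    (hB : B.head? = some false) (hBlen : B.length = 2 * v) :
    ¬ FirstWin (R ::ₘ B ::ₘ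
      (Multiset.replicate 3 [true] + Multiset.replicate k [false])) := by
  have hk2 := Nat.odd_iff.1 hkodd
  refine (Babylon.firstWinAux_of_heights _ ⟨R ::ₘ Multiset.replicate 3 [true],
    B ::ₘ Multiset.replicate k [false], ?_, ?_, ?_, rfl, rfl⟩ rfl).1 ?_
  · simp only [← Multiset.singleton_add]; abel
  · intro s hs
    rcases Multiset.mem_cons.1 hs with rfl | hs
    · exact hR
    · rw [Multiset.eq_of_mem_replicate hs]; rfl
  · intro s hs
    rcases Multiset.mem_cons.1 hs with rfl | hs
    · exact hB
    · rw [Multiset.eq_of_mem_replicate hs]; rfl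
  · simp only [Multiset.map_cons, Multiset.map_replicate, hRlen, hBlen]
    apply Babylon.lose_three_of_odd <;> omega
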